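/- Define Φ : 2^ω → 3^ω by Φ(x)(2k) = x(k) and Φ(x)(2k+1) = 2 for all k ∈ ω. Then range(Φ) ⊆ A = {x ∈ 3^ω : ∀n, x(n) ≠ x(n+1)}, and for all x, y ∈ 2^ω: x E²_tail y if and only if Φ(x) E³_tail Φ(y). Hence Φ is a continuous (in particular Borel) reduction of E²_tail into E³_tail ↾ A. -/

import Mathlib

open Set Function

/-- The tail equivalence relation `E_tail` on `n^ω`: `x E_tail y` iff
`∃ r s ∀ a, x (r+a) = y (s+a)`. -/
def Etail {α : Type*} (x y : ℕ → α) : Prop := ∃ r s, ∀ a, x (r + a) = y (s + a)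

/-- `A = {x ∈ 3^ω : ∀ n, x n ≠ x (n+1)}`. -/
def A3 : Set (ℕ → Fin 3) := {x | ∀ n, x n ≠ x (n + 1)}

/-- The map `Φ : 2^ω → 3^ω` with `Φ(x)(2k) = x(k)` and `Φ(x)(2k+1) = 2`. -/
def phi12 (x : ℕ → Bool) : ℕ → Fin 3 :=
  fun n => if n % 2 = 1 then 2 else if x (n / 2) then 1 else 0

theorem phi12_two_mul (x : ℕ → Bool) (k : ℕ) : phi12 x (2 * k) = if x k then 1 else 0 := by
  simp [phi12]

theorem phi12_two_mul_add_one (x : ℕ → Bool) (k : ℕ) : phi12 x (2 * k + 1) = 2 := by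
  simp [phi12, Nat.add_mod]

theorem phi12_eq_two_iff (x : ℕ → Bool) (n : ℕ) : phi12 x n = 2 ↔ n % 2 = 1 := by
  unfold phi12
  split_ifs with h <;> simp [h]

theorem phi12_two_mul_inj {x y : ℕ → Bool} {k l : ℕ} :
    phi12 x (2 * k) = phi12 y (2 * l) ↔ x k = y l := by
  rw [phi12_two_mul, phi12_two_mul]
  cases x k <;> cases y l <;> simp

theorem continuous_phi12 : Continuous phi12 := by
  refine continuous_pi fun n => ?_
  unfold phi12
  split_ifs
  · exact continuous_const
  · exact (continuous_of_discreteTopology (f := fun b : Bool => if b then (1 : Fin 3) else 0)).comp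
      (continuous_apply (n / 2))

theorem phi12_mem_A3 (x : ℕ → Bool) : phi12 x ∈ A3 := by
  intro n h
  have h₂ : phi12 x n = 2 ↔ phi12 x (n + 1) = 2 := by rw [h]
  rw [phi12_eq_two_iff, phi12_eq_two_iff] at h₂
  omega

theorem Etail.phi12 {x y : ℕ → Bool} (h : Etail x y) : Etail (phi12 x) (phi12 y) := by
  obtain ⟨r, s, h⟩ := h
  refine ⟨2 * r, 2 * s, fun a => ?_⟩
  obtain ⟨k, rfl | rfl⟩ := a.even_or_odd'
  · rw [← mul_add, ← mul_add, phi12_two_mul_inj]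
    exact h k
  · rw [← add_assoc, ← add_assoc, ← mul_add, ← mul_add, phi12_two_mul_add_one,
      phi12_two_mul_add_one]

theorem Etail.of_phi12 {x y : ℕ → Bool} (h : Etail (_root_.phi12 x) (_root_.phi12 y)) :
    Etail x y := by
  obtain ⟨r, s, h⟩ := h
  have parity : r % 2 = 1 ↔ s % 2 = 1 := by
    rw [← phi12_eq_two_iff x, ← phi12_eq_two_iff y]
    exact iff_of_eq (congrArg (· = 2) (h 0))
  refine ⟨(r + 1) / 2, (s + 1) / 2, fun a => ?_⟩
  have key := h (2 * a + r % 2)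
  rw [show r + (2 * a + r % 2) = 2 * ((r + 1) / 2 + a) by omega,
    show s + (2 * a + r % 2) = 2 * ((s + 1) / 2 + a) by omega] at key
  exact phi12_two_mul_inj.1 key

/-- `phi12` is a continuous (hence Borel) reduction of `E²_tail` into `E³_tail ↾ A`. -/
theorem phi12_reduces_tail :
    Continuous phi12 ∧ range phi12 ⊆ A3 ∧
      ∀ x y : ℕ → Bool, Etail x y ↔ Etail (phi12 x) (phi12 y) :=
  ⟨continuous_phi12, range_subset_iff.2 phi12_mem_A3, fun _ _ => ⟨Etail.phi12, Etail.of_phi12⟩⟩
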